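/- For every natural number n, the number of partitions of n with consecutive parts differing by at least 2 and smallest part at least 2 equals the number of partitions of n into parts congruent to ±2 modulo 5. -/

import Mathlib

namespace RR
open Finset

section ring
variable {R : Type*} [CommRing R]

/-- `∏_{i=1}^{l} (1 - q^{r+i})`. -/
def W (q : R) (l r : ℕ) : R := ∏ i ∈ range l, (1 - q ^ (r + 1 + i))

lemma W_succ_right (q : R) (l r : ℕ) : W q (l + 1) r = W q l r * (1 - q ^ (l + 1 + r)) := by
  unfold W
  rw [prod_range_succ]
  congr 3
  ring

lemma W_succ_left (q : R) (l r : ℕ) : W q (l + 1) r = W q l (r + 1) * (1 - q ^ (r + 1)) := by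
  unfold W
  rw [prod_range_succ']
  congr 1
  refine prod_congr rfl fun i _ => ?_
  congr 2
  ring

/-- Truncated sums; `k = l + 1`. -/
def S (q : R) (N l : ℕ) : R :=
  ∑ r ∈ range N, (-1) ^ r * q ^ (2 * (l + 1) * r + 5 * r.choose 2 + r)
    * (1 - q ^ (2 * (l + 1) + 4 * r)) * W q l r

def T (q : R) (N l : ℕ) : R :=
  ∑ r ∈ range N, (-1) ^ r * q ^ (2 * (l + 1) * r + 5 * r.choose 2 + 2 * r)
    * (1 - q ^ (l + 1 + 2 * r)) * W q l r

lemma choose_two_succ (r : ℕ) : (r + 1).choose 2 = r.choose 2 + r := by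
  rw [Nat.choose_succ_succ' r 1]; simp [add_comm]

lemma T_eq (q : R) (N l : ℕ) :
    T q (N + 1) l = S q N (l + 1) +
      (-1) ^ N * q ^ (2 * (l + 1) * N + 5 * N.choose 2 + 3 * N) * W q (l + 1) N := by
  induction N with
  | zero => simp [T, S, W_succ_right]; ring
  | succ N ih =>
    unfold T S at *
    rw [sum_range_succ, ih, sum_range_succ _ N, choose_two_succ, W_succ_right q l (N + 1),
      W_succ_left q l N]
    ring

lemma S_eq (q : R) (N l : ℕ) :
    S q (N + 1) l - T q (N + 1) l = q ^ (l + 1) * T q N (l + 1) +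
      (-1) ^ N * q ^ (2 * (l + 1) * N + 5 * N.choose 2 + N + (l + 1) + 3 * N) * W q (l + 1) N := by
  induction N with
  | zero => simp [T, S, W_succ_right]; ring
  | succ N ih =>
    unfold T S at *
    rw [sum_range_succ, sum_range_succ _ (N + 1), add_sub_add_comm, ih, sum_range_succ _ N,
      choose_two_succ, W_succ_right q l (N + 1), W_succ_left q l N]
    ring

variable {q : R} {M : ℕ}

lemma pow_zero_of_le (hq : q ^ M = 0) {a : ℕ} (h : M ≤ a) : q ^ a = 0 := pow_eq_zero_of_le h hq

lemma S_stable (hq : q ^ M = 0) (N l : ℕ) (h : M ≤ N) : S q (N + 1) l = S q N l := by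
  unfold S
  rw [sum_range_succ, pow_zero_of_le hq (by omega : M ≤ 2 * (l + 1) * N + 5 * N.choose 2 + N)]
  simp

lemma T_stable (hq : q ^ M = 0) (N l : ℕ) (h : M ≤ N) : T q (N + 1) l = T q N l := by
  unfold T
  rw [sum_range_succ, pow_zero_of_le hq (by omega : M ≤ 2 * (l + 1) * N + 5 * N.choose 2 + 2 * N)]
  simp

lemma T_eq_S (hq : q ^ M = 0) (l : ℕ) : T q M l = S q M (l + 1) := by
  rw [← T_stable hq M l le_rfl, T_eq,
    pow_zero_of_le hq (by omega : M ≤ 2 * (l + 1) * M + 5 * M.choose 2 + 3 * M)]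
  simp

lemma S_rec (hq : q ^ M = 0) (l : ℕ) : S q M l = S q M (l + 1) + q ^ (l + 1) * S q M (l + 2) := by
  have h := S_eq q M l
  rw [S_stable hq M l le_rfl, T_stable hq M l le_rfl, T_eq_S hq, T_eq_S hq,
    pow_zero_of_le hq (by omega : M ≤ 2 * (l + 1) * M + 5 * M.choose 2 + M + (l + 1) + 3 * M)] at h
  linear_combination h

/-- `(q)_n` -/
def poch (q : R) (n : ℕ) : R := ∏ i ∈ range n, (1 - q ^ (i + 1))

lemma poch_succ (q : R) (n : ℕ) : poch q (n + 1) = poch q n * (1 - q ^ (n + 1)) :=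
  prod_range_succ _ _

lemma poch_stable (hq : q ^ M = 0) (n : ℕ) (h : M ≤ n) : poch q n = poch q M := by
  induction n, h using Nat.le_induction with
  | base => rfl
  | succ n h ih => rw [poch_succ, ih, pow_zero_of_le hq (by omega)]; simp

lemma S_large (hq : q ^ M = 0) (hM : 0 < M) (l : ℕ) (h : M ≤ l) : S q M l = poch q M := by
  unfold S
  obtain ⟨M, rfl⟩ : ∃ m, M = m + 1 := ⟨M - 1, by omega⟩
  rw [sum_range_succ', sum_eq_zero, ← poch_stable hq l h]
  · simp only [Nat.choose_zero_succ, mul_zero, pow_zero, add_zero]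
    rw [pow_zero_of_le hq (by omega)]
    simp [W, poch, add_comm]
  · intro r _
    rw [pow_zero_of_le hq (a := 2 * (l + 1) * (r + 1) + 5 * (r + 1).choose 2 + (r + 1))
      (by nlinarith)]
    simp

lemma isUnit_one_sub (hq : q ^ M = 0) (i : ℕ) : IsUnit (1 - q ^ (i + 1)) :=
  IsNilpotent.isUnit_one_sub ⟨M, by rw [← pow_mul, pow_zero_of_le hq (by nlinarith)]⟩

lemma isUnit_poch (hq : q ^ M = 0) (n : ℕ) : IsUnit (poch q n) := by
  induction n with
  | zero => simp [poch]
  | succ n ih => rw [poch_succ]; exact ih.mul (isUnit_one_sub hq n)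

/-- Gaussian binomials. -/
def gb (Q : R) : ℕ → ℕ → R
  | _, 0 => 1
  | 0, _ + 1 => 0
  | n + 1, k + 1 => Q ^ (k + 1) * gb Q n (k + 1) + gb Q n k

lemma gb_zero_right (Q : R) (n : ℕ) : gb Q n 0 = 1 := by cases n <;> rfl

lemma gb_succ (Q : R) (n k : ℕ) :
    gb Q (n + 1) (k + 1) = Q ^ (k + 1) * gb Q n (k + 1) + gb Q n k := rfl

lemma gb_eq_zero (Q : R) (n k : ℕ) (h : n < k) : gb Q n k = 0 := by
  induction n generalizing k with
  | zero => obtain ⟨k, rfl⟩ : ∃ m, k = m + 1 := ⟨k - 1, by omega⟩; rfl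
  | succ n ih =>
    obtain ⟨k, rfl⟩ : ∃ m, k = m + 1 := ⟨k - 1, by omega⟩
    rw [gb_succ, ih _ (by omega), ih _ (by omega)]; simp

lemma gb_mul (Q : R) (n a b : ℕ) (h : a + b = n) :
    gb Q n a * poch Q a * poch Q b = poch Q n := by
  induction n generalizing a b with
  | zero => obtain ⟨rfl, rfl⟩ : a = 0 ∧ b = 0 := by omega
            simp [gb_zero_right, poch]
  | succ n ih =>
    rcases a with _ | a
    · obtain rfl : b = n + 1 := by omega
      simp [gb_zero_right, poch]
    rcases b with _ | b
    · have h1 := ih a 0 (by omega)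
      obtain rfl : a = n := by omega
      rw [gb_succ, gb_eq_zero _ _ _ (by omega), poch_succ]
      linear_combination (1 - Q ^ (a + 1)) * h1
    · have h1 := ih (a + 1) b (by omega)
      have h2 := ih a (b + 1) (by omega)
      have : n = a + b + 1 := by omega
      subst this
      rw [gb_succ]
      rw [poch_succ Q (a + b + 1)]
      simp only [poch_succ] at *
      linear_combination Q ^ (a + 1) * (1 - Q ^ (b + 1)) * h1 + (1 - Q ^ (a + 1)) * h2

lemma gb_symm {Q : R} (hq : Q ^ M = 0) (a b : ℕ) : gb Q (a + b) a = gb Q (a + b) b := by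
  have h1 := gb_mul Q (a + b) a b rfl
  have h2 := gb_mul Q (a + b) b a (by omega)
  have h3 := (isUnit_poch hq a).mul (isUnit_poch hq b)
  apply h3.mul_right_cancel
  linear_combination h1 - h2

lemma gb_succ' {Q : R} (hq : Q ^ M = 0) (n k : ℕ) (h : k ≤ n) :
    gb Q (n + 1) (k + 1) = gb Q n (k + 1) + Q ^ (n - k) * gb Q n k := by
  obtain ⟨b, rfl⟩ : ∃ b, n = k + b := ⟨n - k, by omega⟩
  have e1 := gb_symm hq (k + 1) b
  rw [show k + 1 + b = k + b + 1 by omega] at e1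
  rw [e1]
  rcases b with _ | b
  · rw [gb_zero_right, gb_eq_zero _ _ (k + 1) (by omega), gb_symm hq, gb_zero_right]; simp
  · rw [gb_succ, show k + (b + 1) = k + 1 + b by omega, ← gb_symm hq (k + 1) b,
      show k + 1 + b = k + (b + 1) by omega, ← gb_symm hq k (b + 1)]
    rw [show k + (b + 1) - k = b + 1 by omega]; ring

/-- Theta terms `(-1)^j q^{j(5j+3)/2}`. -/
def u (q : R) : ℤ → R
  | Int.ofNat r => (-1) ^ r * q ^ (5 * r.choose 2 + 4 * r)
  | Int.negSucc r => (-1) ^ (r + 1) * q ^ (5 * r.choose 2 + 6 * r + 1)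

lemma u_nat (q : R) (r : ℕ) : u q (r : ℤ) = (-1) ^ r * q ^ (5 * r.choose 2 + 4 * r) := rfl

lemma u_neg (q : R) (r : ℕ) :
    u q (-1 - (r : ℤ)) = (-1) ^ (r + 1) * q ^ (5 * r.choose 2 + 6 * r + 1) := by
  rw [show -1 - (r : ℤ) = Int.negSucc r by omega]; rfl

lemma u_succ (q : R) (r : ℕ) : u q ((r : ℤ) + 1) = - q ^ (5 * r + 4) * u q r := by
  rw [show (r : ℤ) + 1 = ((r + 1 : ℕ) : ℤ) by push_cast; rfl, u_nat, u_nat, choose_two_succ]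
  ring

lemma u_pred (q : R) (r : ℕ) : u q (-1 - (r : ℤ)) = - q ^ (5 * r + 1) * u q (-(r : ℤ)) := by
  rcases r with _ | r
  · have := u_neg q 0
    have h0 := u_nat q 0
    simp at this h0
    simp [this, h0]
  · rw [u_neg, show -((r + 1 : ℕ) : ℤ) = -1 - r by push_cast; ring, u_neg, choose_two_succ]
    ring

/-- relation for raising the `n` side; `j = k - n` -/
lemma u_rel1 (q : R) (k n : ℕ) :
    (q ^ 5) ^ k * u q ((k : ℤ) - n - 1) = - q ^ (5 * n + 1) * u q ((k : ℤ) - n) := by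
  rcases le_or_gt k n with h | h
  · obtain ⟨d, rfl⟩ : ∃ d, n = k + d := ⟨n - k, by omega⟩
    rw [show (k : ℤ) - ((k + d : ℕ) : ℤ) - 1 = -1 - d by push_cast; ring,
      show (k : ℤ) - ((k + d : ℕ) : ℤ) = - d by push_cast; ring, u_pred]
    ring
  · obtain ⟨d, rfl⟩ : ∃ d, k = n + d + 1 := ⟨k - n - 1, by omega⟩
    rw [show ((n + d + 1 : ℕ) : ℤ) - n - 1 = d by push_cast; ring,
      show ((n + d + 1 : ℕ) : ℤ) - n = d + 1 by push_cast; ring, u_succ]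
    ring

/-- relation for raising the `m` side -/
lemma u_rel2 (q : R) (k m n : ℕ) (h : k ≤ m + n) :
    (q ^ 5) ^ (m + n - k) * u q ((k : ℤ) - n + 1) = - q ^ (5 * m + 4) * u q ((k : ℤ) - n) := by
  obtain ⟨c, hc⟩ : ∃ c, m + n = k + c := ⟨m + n - k, by omega⟩
  rw [hc, show k + c - k = c by omega]
  rcases le_or_gt n k with h | h
  · obtain ⟨d, rfl⟩ : ∃ d, k = n + d := ⟨k - n, by omega⟩
    rw [show ((n + d : ℕ) : ℤ) - n = d by push_cast; ring, u_succ]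
    obtain rfl : m = d + c := by omega
    ring
  · obtain ⟨d, rfl⟩ : ∃ d, n = k + d + 1 := ⟨n - k - 1, by omega⟩
    rw [show (k : ℤ) - ((k + d + 1 : ℕ) : ℤ) = -1 - d by push_cast; ring, u_pred,
      show -1 - (d : ℤ) + 1 = - d by ring]
    obtain rfl : c = m + d + 1 := by omega
    ring

lemma jtp_n (q : R) (n : ℕ) :
    ∏ i ∈ range n, (1 - q ^ (5 * i + 1)) =
      ∑ k ∈ range (n + 1), gb (q ^ 5) n k * u q ((k : ℤ) - n) := by
  induction n with
  | zero => simp [gb_zero_right]; exact (by simpa using (u_nat q 0).symm)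
  | succ n ih =>
    rw [prod_range_succ, ih, sum_range_succ' _ (n + 1)]
    simp only [gb_succ, add_mul, sum_add_distrib, gb_zero_right]
    have e1 : ∑ k ∈ range (n + 1), gb (q ^ 5) n k * u q (((k + 1 : ℕ) : ℤ) - ((n + 1 : ℕ) : ℤ))
        = ∑ k ∈ range (n + 1), gb (q ^ 5) n k * u q ((k : ℤ) - n) := by
      refine sum_congr rfl fun k _ => ?_
      congr 2; push_cast; ring
    have e2 : ∑ k ∈ range (n + 1),
        (q ^ 5) ^ (k + 1) * gb (q ^ 5) n (k + 1) * u q (((k + 1 : ℕ) : ℤ) - ((n + 1 : ℕ) : ℤ))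
        + 1 * u q (((0 : ℕ) : ℤ) - ((n + 1 : ℕ) : ℤ))
        = ∑ k ∈ range (n + 1), gb (q ^ 5) n k * u q ((k : ℤ) - n) * (- q ^ (5 * n + 1)) := by
      have : ∀ k : ℕ, gb (q ^ 5) n k * u q ((k : ℤ) - n) * (- q ^ (5 * n + 1))
          = (q ^ 5) ^ k * gb (q ^ 5) n k * u q ((k : ℤ) - ((n + 1 : ℕ) : ℤ)) := by
        intro k
        have := u_rel1 q k n
        rw [show (k : ℤ) - ((n + 1 : ℕ) : ℤ) = k - n - 1 by push_cast; ring]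
        linear_combination - gb (q ^ 5) n k * this
      simp only [this]
      rw [sum_range_succ, gb_eq_zero _ n (n + 1) (by omega), sum_range_succ' _ n]
      simp [gb_zero_right]
    rw [e1, add_right_comm, e2, ← sum_mul]
    ring

lemma jtp (hq : q ^ M = 0) (m n : ℕ) :
    (∏ i ∈ range n, (1 - q ^ (5 * i + 1))) * ∏ i ∈ range m, (1 - q ^ (5 * i + 4)) =
      ∑ k ∈ range (m + n + 1), gb (q ^ 5) (m + n) k * u q ((k : ℤ) - n) := by
  have hQ : (q ^ 5) ^ M = 0 := by rw [← pow_mul, pow_zero_of_le hq (by omega)]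
  induction m with
  | zero => simp [jtp_n]
  | succ m ih =>
    rw [prod_range_succ, ← mul_assoc, ih, show m + 1 + n = m + n + 1 by omega, sum_range_succ' _ (m + n + 1)]
    have e : ∑ k ∈ range (m + n + 1), gb (q ^ 5) (m + n + 1) (k + 1) * u q (((k + 1 : ℕ) : ℤ) - n)
      = ∑ k ∈ range (m + n + 1), gb (q ^ 5) (m + n) (k + 1) * u q (((k + 1 : ℕ) : ℤ) - n)
        + ∑ k ∈ range (m + n + 1), gb (q ^ 5) (m + n) k * u q ((k : ℤ) - n)
            * (- q ^ (5 * m + 4)) := by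
      rw [← sum_add_distrib]
      refine sum_congr rfl fun k hk => ?_
      have hk : k ≤ m + n := by simp at hk; omega
      have := u_rel2 q k m n hk
      rw [gb_succ' hQ _ _ hk, show ((k + 1 : ℕ) : ℤ) - n = k - n + 1 by push_cast; ring]
      linear_combination gb (q ^ 5) (m + n) k * this
    have e3 : ∑ k ∈ range (m + n + 1), gb (q ^ 5) (m + n) (k + 1) * u q (((k + 1 : ℕ) : ℤ) - n)
        + gb (q ^ 5) (m + n) 0 * u q (((0 : ℕ) : ℤ) - n)
        = ∑ k ∈ range (m + n + 1), gb (q ^ 5) (m + n) k * u q ((k : ℤ) - n) := by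
      rw [← sum_range_succ' (fun k : ℕ => gb (q ^ 5) (m + n) k * u q ((k : ℤ) - n)),
        sum_range_succ _ (m + n + 1), gb_eq_zero _ (m + n) (m + n + 1) (by omega)]
      simp
    rw [e, ← sum_mul, ← e3]
    simp only [gb_zero_right]
    ring

lemma u_zero_nat (hq : q ^ M = 0) (r : ℕ) (h : M ≤ r) : u q (r : ℤ) = 0 := by
  rw [u_nat, pow_zero_of_le hq (by omega)]; simp

lemma u_zero_neg (hq : q ^ M = 0) (r : ℕ) (h : M ≤ r + 1) : u q (-1 - (r : ℤ)) = 0 := by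
  rw [u_neg, pow_zero_of_le hq (by omega)]; simp

lemma gb_lim {Q : R} (hQ : Q ^ M = 0) (a b : ℕ) (ha : M ≤ a) (hb : M ≤ b) :
    gb Q (a + b) a * poch Q M = 1 := by
  have h := gb_mul Q (a + b) a b rfl
  rw [poch_stable hQ a ha, poch_stable hQ b hb, poch_stable hQ (a + b) (by omega)] at h
  apply (isUnit_poch hQ M).mul_right_cancel
  rw [h]; simp

lemma theta (hq : q ^ M = 0) :
    (∏ i ∈ range (2 * M), (1 - q ^ (5 * i + 1))) * (∏ i ∈ range (2 * M), (1 - q ^ (5 * i + 4)))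
      * poch (q ^ 5) M = T q M 0 := by
  have hQ : (q ^ 5) ^ M = 0 := by rw [← pow_mul, pow_zero_of_le hq (by omega)]
  have hT : ∀ N, M ≤ N → T q N 0 = T q M 0 := by
    intro N h
    induction N, h using Nat.le_induction with
    | base => rfl
    | succ n h ih => rw [T_stable hq _ _ h, ih]
  rw [jtp hq, sum_mul, ← hT (2 * M) (by omega)]
  have e : ∀ k ∈ range (2 * M + 2 * M + 1),
      gb (q ^ 5) (2 * M + 2 * M) k * u q ((k : ℤ) - ((2 * M : ℕ) : ℤ)) * poch (q ^ 5) M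
        = u q ((k : ℤ) - ((2 * M : ℕ) : ℤ)) := by
    intro k hk
    have hk : k ≤ 2 * M + 2 * M := by simp at hk; omega
    by_cases h1 : k < M
    · rw [show (k : ℤ) - ((2 * M : ℕ) : ℤ) = -1 - ((2 * M - k - 1 : ℕ) : ℤ) by omega,
        u_zero_neg hq _ (by omega)]; simp
    by_cases h2 : 3 * M < k
    · rw [show (k : ℤ) - ((2 * M : ℕ) : ℤ) = ((k - 2 * M : ℕ) : ℤ) by omega,
        u_zero_nat hq _ (by omega)]; simp
    have := gb_lim hQ k (2 * M + 2 * M - k) (by omega) (by omega)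
    rw [show k + (2 * M + 2 * M - k) = 2 * M + 2 * M by omega] at this
    linear_combination u q ((k : ℤ) - ((2 * M : ℕ) : ℤ)) * this
  rw [sum_congr rfl e, sum_range_succ, show ((2 * M + 2 * M : ℕ) : ℤ) - ((2 * M : ℕ) : ℤ)
    = ((2 * M : ℕ) : ℤ) by push_cast; ring, u_zero_nat hq _ (by omega), add_zero,
    sum_range_add, ← sum_range_reflect, ← sum_add_distrib]
  unfold T
  refine sum_congr rfl fun r hr => ?_
  have hr : r < 2 * M := by simpa using hr
  rw [show ((2 * M - 1 - r : ℕ) : ℤ) - ((2 * M : ℕ) : ℤ) = -1 - r by omega,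
    show ((2 * M + r : ℕ) : ℤ) - ((2 * M : ℕ) : ℤ) = r by omega, u_nat, u_neg]
  simp [W]
  ring

lemma poch5 (q : R) (N : ℕ) :
    poch q (5 * N) = (∏ i ∈ range N, (1 - q ^ (5 * i + 1))) * (∏ i ∈ range N, (1 - q ^ (5 * i + 4)))
      * poch (q ^ 5) N * ∏ i ∈ range N, ((1 - q ^ (5 * i + 2)) * (1 - q ^ (5 * i + 3))) := by
  induction N with
  | zero => simp [poch]
  | succ N ih =>
    rw [show 5 * (N + 1) = 5 * N + 1 + 1 + 1 + 1 + 1 by ring]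
    simp only [poch_succ, prod_range_succ]
    rw [ih]
    ring

/-- The core analytic statement. -/
lemma core (hq : q ^ M = 0) (hM : 0 < M) (g : ℕ → R)
    (hrec : ∀ k, 1 ≤ k → g k = g (k + 1) + q ^ k * g (k + 2)) (hlim : ∀ k, M ≤ k → g k = 1) :
    g 2 * ∏ i ∈ range (2 * M), ((1 - q ^ (5 * i + 2)) * (1 - q ^ (5 * i + 3))) = 1 := by
  have hQ : (q ^ 5) ^ M = 0 := by rw [← pow_mul, pow_zero_of_le hq (by omega)]
  have key : ∀ d l, M ≤ l + d → S q M l = poch q M * g (l + 1) := by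
    intro d
    induction d using Nat.strong_induction_on with
    | _ d ih =>
      intro l hl
      by_cases h : M ≤ l
      · rw [S_large hq hM l h, hlim _ (by omega), mul_one]
      · have a1 := ih (d - 1) (by omega) (l + 1) (by omega)
        have a2 := ih (d - 1) (by omega) (l + 2) (by omega)
        rw [S_rec hq, hrec (l + 1) (by omega), a1, a2]
        ring
  have h2 := key M 1 (by omega)
  rw [show (1 : ℕ) = 0 + 1 by rfl, ← T_eq_S hq, ← theta hq,
    ← poch_stable hq (5 * (2 * M)) (by omega), poch5, poch_stable hQ (2 * M) (by omega)] at h2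
  set A := (∏ i ∈ range (2 * M), (1 - q ^ (5 * i + 1)))
      * (∏ i ∈ range (2 * M), (1 - q ^ (5 * i + 4))) * poch (q ^ 5) M with hA
  have hu : IsUnit A := by
    have := isUnit_poch hq (5 * (2 * M))
    rw [poch5, poch_stable hQ (2 * M) (by omega), ← hA] at this
    exact isUnit_of_mul_isUnit_left this
  apply hu.mul_left_cancel
  simp only [zero_add, Nat.reduceAdd] at h2
  rw [mul_one]
  linear_combination -h2

end ring

def L (k n : ℕ) : Set (List ℕ) :=
  {l | (∀ x ∈ l, k ≤ x) ∧ l.IsChain (fun a b => b + 2 ≤ a) ∧ l.sum = n}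

lemma mem_L (k n : ℕ) (l : List ℕ) :
    l ∈ L k n ↔ (∀ x ∈ l, k ≤ x) ∧ l.Pairwise (fun a b => b + 2 ≤ a) ∧ l.sum = n := by
  haveI : IsTrans ℕ (fun a b => b + 2 ≤ a) := ⟨fun a b c h1 h2 => by omega⟩
  unfold L
  rw [Set.mem_setOf_eq, List.isChain_iff_pairwise]

lemma L_finite (k n : ℕ) (hk : 1 ≤ k) : (L k n).Finite := by
  refine (Set.finite_range (fun c : Composition n => c.blocks)).subset ?_
  rintro l ⟨h1, -, h3⟩
  exact ⟨⟨l, fun {i} hi => by have := h1 i hi; omega, h3⟩, rfl⟩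

lemma L_rec (k n : ℕ) :
    L k (n + k) = L (k + 1) (n + k) ∪ (fun l => l ++ [k]) '' L (k + 2) n := by
  ext l
  simp only [Set.mem_union, Set.mem_image, mem_L]
  constructor
  · rintro ⟨h1, h2, h3⟩
    rcases List.eq_nil_or_concat l with rfl | ⟨l', a, rfl⟩
    · left; simpa using h3
    · simp only [List.concat_eq_append, List.pairwise_append, List.mem_append, List.mem_singleton,
        List.sum_append, List.sum_singleton] at *
      obtain ⟨h4, -, h5⟩ := h2
      have ha := h1 a (Or.inr rfl)
      by_cases hak : a = k
      · right
        subst hak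
        refine ⟨l', ⟨fun x hx => h5 x hx a rfl, h4, by omega⟩, rfl⟩
      · left
        refine ⟨?_, ⟨h4, List.pairwise_singleton _ _, h5⟩, h3⟩
        rintro x (hx | rfl)
        · have := h5 x hx a rfl; omega
        · omega
  · rintro (⟨h1, h2, h3⟩ | ⟨l', ⟨h1, h2, h3⟩, rfl⟩)
    · exact ⟨fun x hx => by have := h1 x hx; omega, h2, h3⟩
    · simp only [List.pairwise_append, List.mem_append, List.mem_singleton,
        List.sum_append, List.sum_singleton]
      refine ⟨?_, ⟨h2, List.pairwise_singleton _ _, ?_⟩, by omega⟩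
      · rintro x (hx | rfl)
        · have := h1 x hx; omega
        · omega
      · rintro x hx b rfl
        exact h1 x hx

lemma L_small (k n : ℕ) (h : n < k) : L k n = if n = 0 then {[]} else ∅ := by
  ext l
  rw [mem_L]
  constructor
  · rintro ⟨h1, h2, h3⟩
    rcases l with _ | ⟨a, l⟩
    · simp at h3; simp [← h3]
    · have := h1 a (by simp)
      simp at h3; omega
  · split_ifs with h0
    · rintro rfl; simp [h0]
    · simp

lemma card_rec (k n : ℕ) (hk : 1 ≤ k) :
    (L k (n + k)).ncard = (L (k + 1) (n + k)).ncard + (L (k + 2) n).ncard := by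
  rw [L_rec, Set.ncard_union_eq ?_ (L_finite _ _ (by omega)) ((L_finite _ _ (by omega)).image _),
    Set.ncard_image_of_injective]
  · intro a b h; simpa using h
  · rw [Set.disjoint_left]
    rintro l h1 ⟨l', -, rfl⟩
    have := h1.1 k (by simp)
    omega

open PowerSeries

noncomputable def G (k : ℕ) : ℤ⟦X⟧ := PowerSeries.mk fun n => ((L k n).ncard : ℤ)

lemma G_rec (k : ℕ) (hk : 1 ≤ k) : G k = G (k + 1) + X ^ k * G (k + 2) := by
  ext n
  rw [map_add, coeff_X_pow_mul']
  simp only [G, coeff_mk]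
  split_ifs with h
  · obtain ⟨m, rfl⟩ : ∃ m, n = m + k := ⟨n - k, by omega⟩
    rw [card_rec k m hk]; simp
  · rw [L_small k n (by omega), L_small (k + 1) n (by omega)]; simp

lemma G_small (k M : ℕ) (h : M ≤ k) : X ^ M ∣ G k - 1 := by
  rw [X_pow_dvd_iff]
  intro m hm
  simp only [G, map_sub, coeff_mk, coeff_one]
  rw [L_small k m (by omega)]
  split_ifs <;> simp

open PowerSeries.WithPiTopology in
lemma B_eq (p : ℕ → Prop) [DecidablePred p] (M : ℕ) :
    ∃ N0, ∀ N, N0 ≤ N → (X : ℤ⟦X⟧) ^ M ∣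
      (PowerSeries.mk fun n => ((Nat.Partition.restricted n p).card : ℤ))
        * ∏ i ∈ range N, (if p (i + 1) then 1 - X ^ (i + 1) else 1) - 1 := by
  have h := (Nat.Partition.hasProd_powerSeriesMk_card_restricted ℤ p).tendsto_prod_nat
  rw [WithPiTopology.tendsto_iff_coeff_tendsto] at h
  have h2 : ∀ᶠ N in Filter.atTop, ∀ d ∈ range M,
      coeff d (∏ i ∈ range N, (if p (i + 1) then ∑' j : ℕ, (X : ℤ⟦X⟧) ^ ((i + 1) * j) else 1)) =
      coeff d (PowerSeries.mk fun n => ((Nat.Partition.restricted n p).card : ℤ)) := by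
    rw [Filter.eventually_all_finset]
    intro d _
    have := h d
    rw [nhds_discrete, Filter.tendsto_pure] at this
    exact this
  obtain ⟨N0, hN0⟩ := Filter.eventually_atTop.mp h2
  refine ⟨N0, fun N hN => ?_⟩
  have h3 : (X : ℤ⟦X⟧) ^ M ∣
      (PowerSeries.mk fun n => ((Nat.Partition.restricted n p).card : ℤ)) -
      ∏ i ∈ range N, (if p (i + 1) then ∑' j : ℕ, (X : ℤ⟦X⟧) ^ ((i + 1) * j) else 1) := by
    rw [X_pow_dvd_iff]
    intro m hm
    rw [map_sub, hN0 N hN m (by simpa using hm), sub_self]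
  have h4 : (∏ i ∈ range N, (if p (i + 1) then ∑' j : ℕ, (X : ℤ⟦X⟧) ^ ((i + 1) * j) else 1)) *
      ∏ i ∈ range N, (if p (i + 1) then 1 - (X : ℤ⟦X⟧) ^ (i + 1) else 1) = 1 := by
    rw [← prod_mul_distrib]
    refine prod_eq_one fun i _ => ?_
    split_ifs
    · simp_rw [pow_mul]
      exact tsum_pow_mul_one_sub_of_constantCoeff_eq_zero (by simp)
    · simp
  have h5 := h3.mul_right (∏ i ∈ range N, (if p (i + 1) then 1 - (X : ℤ⟦X⟧) ^ (i + 1) else 1))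
  rwa [sub_mul, h4] at h5

lemma prod5 {R : Type*} [CommRing R] (q : R) (N : ℕ) :
    ∏ i ∈ range (5 * N), (if (i + 1) % 5 = 2 ∨ (i + 1) % 5 = 3 then 1 - q ^ (i + 1) else 1)
      = ∏ i ∈ range N, ((1 - q ^ (5 * i + 2)) * (1 - q ^ (5 * i + 3))) := by
  induction N with
  | zero => simp
  | succ N ih =>
    rw [show 5 * (N + 1) = 5 * N + 1 + 1 + 1 + 1 + 1 by ring]
    rw [prod_range_succ _ N]
    iterate 5 rw [prod_range_succ]
    rw [ih, if_neg (by omega), if_pos (by omega), if_pos (by omega), if_neg (by omega),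
      if_neg (by omega)]
    ring

lemma prod_stable {R : Type*} [CommRing R] {q : R} {M : ℕ} (hq : q ^ M = 0) (N : ℕ) (h : M ≤ N) :
    ∏ i ∈ range N, ((1 - q ^ (5 * i + 2)) * (1 - q ^ (5 * i + 3)))
    = ∏ i ∈ range M, ((1 - q ^ (5 * i + 2)) * (1 - q ^ (5 * i + 3))) := by
  induction N, h using Nat.le_induction with
  | base => rfl
  | succ n h ih =>
    rw [prod_range_succ, ih, pow_eq_zero_of_le (by omega) hq, pow_eq_zero_of_le (by omega) hq]; simp

lemma main (n : ℕ) : (L 2 n).ncard =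
    (Nat.Partition.restricted n (fun x => x % 5 = 2 ∨ x % 5 = 3)).card := by
  obtain ⟨N0, hN0⟩ := B_eq (fun x => x % 5 = 2 ∨ x % 5 = 3) (n + 1)
  let φ : ℤ⟦X⟧ →+* ℤ⟦X⟧ ⧸ Ideal.span {(X : ℤ⟦X⟧) ^ (n + 1)} := Ideal.Quotient.mk _
  have hφ : ∀ a b : ℤ⟦X⟧, φ a = φ b ↔ X ^ (n + 1) ∣ a - b := by
    intro a b
    rw [Ideal.Quotient.mk_eq_mk_iff_sub_mem, Ideal.mem_span_singleton]
  have hq : (φ X) ^ (n + 1) = 0 := by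
    rw [← map_pow, ← map_zero φ, hφ]; simp
  have h1 := core hq (by omega) (fun k => φ (G k))
    (fun k hk => by rw [G_rec k hk]; simp)
    (fun k hk => by rw [← map_one φ, hφ]; exact G_small k _ hk)
  have h2 := hN0 (5 * (N0 + (n + 1))) (by omega)
  rw [prod5, ← hφ, map_mul, map_one, map_prod] at h2
  simp only [map_mul, map_sub, map_one, map_pow] at h2
  rw [prod_stable hq _ (by omega)] at h2 h1
  have h3 : φ (G 2) =
      φ (PowerSeries.mk fun n => ((Nat.Partition.restricted n
        (fun x => x % 5 = 2 ∨ x % 5 = 3)).card : ℤ)) := by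
    set P := ∏ i ∈ range (n + 1), ((1 - φ X ^ (5 * i + 2)) * (1 - φ X ^ (5 * i + 3)))
    have : IsUnit P := IsUnit.of_mul_eq_one_right _ h2
    exact this.mul_right_cancel (h1.trans h2.symm)
  rw [hφ, X_pow_dvd_iff] at h3
  have h4 := h3 n (by omega)
  simp only [G, map_sub, coeff_mk, sub_eq_zero] at h4
  exact_mod_cast h4
end RR

/-- For every `n`, the number of partitions of `n` with consecutive parts differing by at least 2
and smallest part at least 2 equals the number of partitions of `n` into parts congruent to
`±2 (mod 5)`. -/
theorem rogers_ramanujan_second_combinatorial (n : ℕ) :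
    Nat.card {l : List ℕ // (∀ x ∈ l, 2 ≤ x) ∧ l.Chain' (fun a b => b + 2 ≤ a) ∧ l.sum = n} =
      Nat.card {p : n.Partition // ∀ x ∈ p.parts, x % 5 = 2 ∨ x % 5 = 3} := by
  have h := RR.main n
  rw [← Nat.card_coe_set_eq] at h
  refine Eq.trans h ?_
  rw [Nat.card_eq_fintype_card, Fintype.card_subtype]
  rfl
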